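/- The subspace of the ℚ-vector space V freely spanned by the 300 γ-pairs generated by all 180 relation vectors R^{st,u}_m together with all edge relation vectors E^{k,k'}_m has dimension exactly 200; equivalently, the quotient of V by this subspace has dimension exactly 100 (there are 100 independent classes of compact γ curves). -/

import Mathlib

/-- The indicator (standard basis) vector of `i : Fin 5`. -/
def e (i : Fin 5) : Fin 5 → ℕ := fun k => if k = i then 1 else 0

/-- The ℚ-vector space freely spanned by unordered pairs of exponent vectors;
the 300 γ-pairs sit among the basis elements. -/
abbrev V : Type := Sym2 (Fin 5 → ℕ) →₀ ℚ

/-- The basis vector `⟨{a, b}⟩` of `V` indexed by the unordered pair `{a, b}`. -/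
noncomputable def gvec (a b : Fin 5 → ℕ) : V := Finsupp.single s(a, b) 1

/-- `{m, n}` is a γ-pair: both are degree-5 exponent vectors, `m = n + e i − e j`
for some `i ≠ j`, and `supp m ∪ supp n` has exactly 3 elements. -/
def IsGammaPair (m n : Fin 5 → ℕ) : Prop :=
  (∑ i, m i) = 5 ∧ (∑ i, n i) = 5 ∧
  (∃ i j : Fin 5, i ≠ j ∧ m = fun k => n k + e i k - e j k) ∧
  (Function.support m ∪ Function.support n).ncard = 3

/-- The relation vector `R^{st,u}_m` attached to a ruling of the compact
divisor `D_m ≅ dP₃`. -/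
noncomputable def Rvec (m : Fin 5 → ℕ) (s t u : Fin 5) : V :=
  gvec m (fun k => m k + e s k - e u k) + gvec m (fun k => m k + e t k - e u k)
    - gvec m (fun k => m k + e u k - e t k)
    - gvec m (fun k => m k + e u k - e s k)

/-- The edge relation vector `E^{k,k'}_m` for an edge divisor `D_m`
(`supp m = {i, j}`). -/
noncomputable def Evec (m : Fin 5 → ℕ) (i j k k' : Fin 5) : V :=
  gvec m (fun l => m l - e i l + e k l) + gvec m (fun l => m l - e j l + e k l)
    - gvec m (fun l => m l - e i l + e k' l)
    - gvec m (fun l => m l - e j l + e k' l)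

/-- The set of the 180 relation vectors `R^{st,u}_m`. -/
def RelSetR : Set V :=
  {v | ∃ (m : Fin 5 → ℕ) (s t u : Fin 5), (∑ i, m i) = 5 ∧
    s ≠ t ∧ s ≠ u ∧ t ≠ u ∧ Function.support m = {s, t, u} ∧
    v = Rvec m s t u}

/-- The set of the edge relation vectors `E^{k,k'}_m`. -/
def RelSetE : Set V :=
  {v | ∃ (m : Fin 5 → ℕ) (i j k k' : Fin 5), (∑ l, m l) = 5 ∧
    i ≠ j ∧ Function.support m = {i, j} ∧
    k ≠ k' ∧ k ∉ ({i, j} : Set (Fin 5)) ∧ k' ∉ ({i, j} : Set (Fin 5)) ∧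
    v = Evec m i j k k'}

/-- The span of all relations among the γ curves. -/
noncomputable def RelSpan : Submodule ℚ V :=
  Submodule.span ℚ (RelSetR ∪ RelSetE)

/-- The subspace of `V` freely spanned by the 300 γ-pairs. -/
noncomputable def GammaSpan : Submodule ℚ V :=
  Submodule.span ℚ {v | ∃ m n : Fin 5 → ℕ, IsGammaPair m n ∧ v = gvec m n}

/-- The support of an exponent vector, as a finset. -/
def expSupp (m : Fin 5 → ℕ) : Finset (Fin 5) := {i | m i ≠ 0}

/-- The indices which together with `T` form a set of three indices. -/
def thirds (T : Finset (Fin 5)) : Finset (Fin 5) := {a | (insert a T).card = 3}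

/-- The exponent vector `m + e a - e b`. -/
def shift (m : Fin 5 → ℕ) (a b : Fin 5) : Fin 5 → ℕ := fun k => m k + e a k - e b k

/-- The degree-5 exponent vectors with two or three nonzero entries. -/
def nodes : Finset (Fin 5 → ℕ) :=
  {m ∈ Finset.Nat.antidiagonalTuple 5 5 | (thirds (expSupp m)).card = 3}

/-- The relation at `m` with potential `y`: the curve in direction `e a - e b` is weighted by
`y b - y a`. -/
noncomputable def starVec (m : Fin 5 → ℕ) : (Fin 5 → ℚ) →ₗ[ℚ] V :=
  ∑ a ∈ thirds (expSupp m), ∑ b ∈ expSupp m,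
    ((LinearMap.proj b : (Fin 5 → ℚ) →ₗ[ℚ] ℚ) - LinearMap.proj a).smulRight (gvec m (shift m a b))

/-- Triples `(m, a, b)` with `a < b`, one for each γ-pair `{m, m + e a - e b}`. -/
def gammaIndex : Finset ((Fin 5 → ℕ) × Fin 5 × Fin 5) :=
  {p ∈ Finset.Nat.antidiagonalTuple 5 5 ×ˢ Finset.univ |
    p.2.1 < p.2.2 ∧ p.1 p.2.2 ≠ 0 ∧ (insert p.2.1 (expSupp p.1)).card = 3}

lemma card_nodes : nodes.card = 100 := by decide +kernel

lemma card_gammaIndex : gammaIndex.card = 300 := by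
  decide +kernel

@[simp] lemma mem_expSupp {m : Fin 5 → ℕ} {i : Fin 5} : i ∈ expSupp m ↔ m i ≠ 0 := by
  simp [expSupp]

lemma mem_thirds {T : Finset (Fin 5)} {a : Fin 5} : a ∈ thirds T ↔ (insert a T).card = 3 := by
  simp [thirds]

lemma card_thirds_of_mem {T : Finset (Fin 5)} {a : Fin 5} (h : a ∈ thirds T) (hT : T ≠ ∅) :
    (thirds T).card = 3 := by
  revert T a; decide

lemma thirds_of_card_three {T : Finset (Fin 5)} (h : T.card = 3) : thirds T = T := by
  revert T; decide

lemma thirds_of_card_two {T : Finset (Fin 5)} (h : T.card = 2) : thirds T = Tᶜ := by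
  revert T; decide

lemma card_eq_of_card_thirds {T : Finset (Fin 5)} (h : (thirds T).card = 3) :
    T.card = 2 ∨ T.card = 3 := by
  revert T; decide

lemma expSupp_ne_empty {m : Fin 5 → ℕ} (h : ∑ i, m i = 5) : expSupp m ≠ ∅ := by
  intro h0
  have : ∀ i, m i = 0 := fun i => by
    by_contra hi
    simpa [h0] using mem_expSupp.2 hi
  simp [this] at h

lemma mem_nodes {m : Fin 5 → ℕ} :
    m ∈ nodes ↔ ∑ i, m i = 5 ∧ (thirds (expSupp m)).card = 3 := by
  simp [nodes, Finset.Nat.mem_antidiagonalTuple]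

lemma mem_gammaIndex {m : Fin 5 → ℕ} {a b : Fin 5} :
    (m, a, b) ∈ gammaIndex ↔
      ∑ i, m i = 5 ∧ a < b ∧ m b ≠ 0 ∧ a ∈ thirds (expSupp m) := by
  simp only [gammaIndex, Finset.mem_filter, Finset.mem_product, Finset.mem_univ, and_true,
    Finset.Nat.mem_antidiagonalTuple, mem_thirds]

attribute [irreducible] nodes gammaIndex

lemma starVec_apply (m : Fin 5 → ℕ) (y : Fin 5 → ℚ) :
    starVec m y = ∑ a ∈ thirds (expSupp m), ∑ b ∈ expSupp m,
      (y b - y a) • gvec m (shift m a b) := by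
  simp [starVec]

lemma shift_apply (m : Fin 5 → ℕ) (a b k : Fin 5) :
    shift m a b k = m k + (if k = a then 1 else 0) - (if k = b then 1 else 0) := rfl

lemma shift_shift {m : Fin 5 → ℕ} {a b : Fin 5} (hab : a ≠ b) (hb : m b ≠ 0) :
    shift (shift m a b) b a = m := by
  funext k
  simp only [shift_apply]
  grind

lemma shift_inj {m : Fin 5 → ℕ} {a b s u : Fin 5} (hsu : s ≠ u) (hu : m u ≠ 0)
    (h : shift m s u = shift m a b) : s = a ∧ u = b := by
  have h1 := congrFun h s
  have h2 := congrFun h u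
  simp only [shift_apply] at h1 h2
  grind

lemma shift_fst_ne_zero {m : Fin 5 → ℕ} {a b : Fin 5} (hab : a ≠ b) : shift m a b a ≠ 0 := by
  simp [shift_apply, hab]

lemma sym2_shift_eq_iff {m p : Fin 5 → ℕ} {s u a b : Fin 5} (hsu : s ≠ u) (hu : m u ≠ 0)
    (hab : a ≠ b) (hb : p b ≠ 0) :
    s(m, shift m s u) = s(p, shift p a b) ↔
      (m = p ∧ s = a ∧ u = b) ∨ (m = shift p a b ∧ s = b ∧ u = a) := by
  rw [Sym2.eq_iff]
  constructor
  · rintro (⟨rfl, h⟩ | ⟨rfl, h⟩)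
    · exact Or.inl ⟨rfl, shift_inj hsu hu h⟩
    · exact Or.inr ⟨rfl, shift_inj hsu hu (h.trans (shift_shift hab hb).symm)⟩
  · rintro (⟨rfl, rfl, rfl⟩ | ⟨rfl, rfl, rfl⟩)
    · exact Or.inl ⟨rfl, rfl⟩
    · exact Or.inr ⟨rfl, shift_shift hab hb⟩

lemma shift_ne_self (m : Fin 5 → ℕ) {a b : Fin 5} (hab : a ≠ b) : shift m a b ≠ m := by
  intro h
  have := congrFun h a
  simp [shift_apply, hab] at this

lemma starVec_coeff (m : Fin 5 → ℕ) (y : Fin 5 → ℚ) {p : Fin 5 → ℕ} {a b : Fin 5} (hab : a ≠ b)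
    (hb : p b ≠ 0) (ha : a ∈ thirds (expSupp p)) (hb' : b ∈ thirds (expSupp (shift p a b))) :
    starVec m y s(p, shift p a b) =
      (if m = p then y b - y a else 0) + (if m = shift p a b then y a - y b else 0) := by
  have key : ∀ s ∈ thirds (expSupp m), ∀ u ∈ expSupp m,
      ((y u - y s) • gvec m (shift m s u)) s(p, shift p a b) =
        (if m = p ∧ s = a ∧ u = b then y b - y a else 0) +
        (if m = shift p a b ∧ s = b ∧ u = a then y a - y b else 0) := by
    intro s _ u hu
    rw [mem_expSupp] at hu
    by_cases hsu : s = u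
    · subst hsu
      rw [sub_self, zero_smul, if_neg, if_neg] <;> simp <;> grind
    rw [Finsupp.smul_apply, gvec, Finsupp.single_apply]
    simp only [sym2_shift_eq_iff hsu hu hab hb]
    have := shift_ne_self p hab
    rw [smul_eq_mul, mul_ite, mul_one, mul_zero]
    grind
  rw [starVec_apply]
  simp only [Finsupp.coe_finsetSum, Finset.sum_apply]
  rw [Finset.sum_congr rfl fun s hs => Finset.sum_congr rfl (key s hs)]
  simp only [Finset.sum_add_distrib]
  have ha' := shift_fst_ne_zero (m := p) hab
  congr 1
  · split_ifs with h
    · subst h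
      rw [Finset.sum_eq_single_of_mem a ha, Finset.sum_eq_single_of_mem b (by simpa)] <;>
        simp +contextual
    · simp [h]
  · split_ifs with h
    · subst h
      rw [Finset.sum_eq_single_of_mem b hb', Finset.sum_eq_single_of_mem a (by simpa)] <;>
        simp +contextual
    · simp [h]

/-- The point of the triangle on the indices `s, t, u` with coordinates `i, j, k`. -/
def trianglePoint (s t u : Fin 5) (i j k : ℕ) : Fin 5 → ℕ :=
  fun l => i * e s l + j * e t l + k * e u l

lemma affine_eq_zero {α β γ : ℕ → ℚ} (hα : α 0 = 0) (hβ : β 0 = 0) (hγ : γ 0 = 0)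
    (h : ∀ i j k, i + j + k = 5 → i < 5 → j < 5 → k < 5 → α i + β j + γ k = 0)
    {i : ℕ} (hi : i < 5) : α i = 0 := by
  have a1 := h 1 4 0
  have a2 := h 2 3 0
  have a3 := h 3 2 0
  have a4 := h 4 1 0
  have b1 := h 0 1 4
  have b2 := h 0 2 3
  have b3 := h 0 3 2
  have b4 := h 0 4 1
  have c1 := h 1 0 4
  have c2 := h 2 0 3
  have c3 := h 3 0 2
  have c4 := h 4 0 1
  have d1 := h 1 1 3
  have d2 := h 1 2 2
  have d3 := h 2 2 1
  norm_num at *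
  interval_cases i <;> linarith

lemma sum_shift {m : Fin 5 → ℕ} {a b : Fin 5} (hab : a ≠ b) (hb : m b ≠ 0) :
    ∑ i, shift m a b i = ∑ i, m i := by
  have h : ∀ i, shift m a b i + (if i = b then 1 else 0) = m i + (if i = a then 1 else 0) := by
    intro i
    simp only [shift_apply]
    grind
  have := Finset.sum_congr (rfl : (Finset.univ : Finset (Fin 5)) = _) fun i _ => h i
  simpa [Finset.sum_add_distrib] using this

lemma insert_expSupp_shift {m : Fin 5 → ℕ} {a b : Fin 5} (hb : m b ≠ 0) :
    insert b (expSupp (shift m a b)) = insert a (expSupp m) := by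
  ext k
  simp only [Finset.mem_insert, mem_expSupp, shift_apply]
  grind

lemma mem_nodes_of_mem_thirds {m : Fin 5 → ℕ} {a : Fin 5} (hm : ∑ i, m i = 5)
    (ha : a ∈ thirds (expSupp m)) : m ∈ nodes :=
  mem_nodes.2 ⟨hm, card_thirds_of_mem ha (expSupp_ne_empty hm)⟩

lemma mem_thirds_shift {m : Fin 5 → ℕ} {a b : Fin 5} (hb : m b ≠ 0)
    (ha : a ∈ thirds (expSupp m)) : b ∈ thirds (expSupp (shift m a b)) := by
  rw [mem_thirds] at ha ⊢
  rwa [insert_expSupp_shift hb]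

lemma trianglePoint_rotate (s t u : Fin 5) (i j k : ℕ) :
    trianglePoint t u s j k i = trianglePoint s t u i j k := by
  funext l
  simp only [trianglePoint]
  ring

lemma eq_trianglePoint {m : Fin 5 → ℕ} {s t u : Fin 5} (hst : s ≠ t) (hsu : s ≠ u) (htu : t ≠ u)
    (h : ∀ l, l ≠ s → l ≠ t → l ≠ u → m l = 0) :
    m = trianglePoint s t u (m s) (m t) (m u) := by
  funext l
  simp only [trianglePoint, e]
  grind

lemma sum_trianglePoint (s t u : Fin 5) (i j k : ℕ) :
    ∑ l, trianglePoint s t u i j k l = i + j + k := by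
  simp [trianglePoint, e, Finset.sum_add_distrib]

lemma shift_trianglePoint (s t u : Fin 5) (i j k : ℕ) :
    shift (trianglePoint s t u i j (k + 1)) t u = trianglePoint s t u i (j + 1) k := by
  funext l
  simp only [shift_apply, trianglePoint, e]
  grind

/-- A potential on exponent vectors whose differences agree along the edges of every triangle and
which is supported on the index sets of the relation vectors. -/
structure IsFlat (x : (Fin 5 → ℕ) → Fin 5 → ℚ) : Prop where
  edge : ∀ p a b, a ≠ b → p b ≠ 0 → ∑ i, p i = 5 → a ∈ thirds (expSupp p) →
    x p b - x p a = x (shift p a b) b - x (shift p a b) a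
  supp : ∀ m ∈ nodes, ∀ a ∉ thirds (expSupp m), x m a = 0
  sum_eq_zero : ∀ m ∈ nodes, ∑ a, x m a = 0

namespace IsFlat

variable {x : (Fin 5 → ℕ) → Fin 5 → ℚ} {s t u : Fin 5}

lemma sub_eq_line (hx : IsFlat x) (hst : s ≠ t) (hsu : s ≠ u) (htu : t ≠ u) (i j k : ℕ)
    (h : i + 1 + j + k = 5) :
    x (trianglePoint s t u (i + 1) j k) t - x (trianglePoint s t u (i + 1) j k) u =
      x (trianglePoint s t u (i + 1) 0 (j + k)) t -
        x (trianglePoint s t u (i + 1) 0 (j + k)) u := by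
  induction j generalizing k with
  | zero => simp
  | succ j ih =>
    have h1 := ih (k + 1) (by omega)
    have h2 := hx.edge (trianglePoint s t u (i + 1) j (k + 1)) t u htu
      (by simp [trianglePoint, e]) (by rw [sum_trianglePoint]; omega)
      (by
        rw [mem_thirds, Finset.card_eq_three]
        refine ⟨s, t, u, hst, hsu, htu, ?_⟩
        ext l
        simp only [Finset.mem_insert, mem_expSupp, trianglePoint, e, Finset.mem_singleton]
        grind)
    rw [shift_trianglePoint] at h2
    rw [show j + 1 + k = j + (k + 1) by ring]
    linarith

lemma sub_eq (hx : IsFlat x) (hst : s ≠ t) (hsu : s ≠ u) (htu : t ≠ u) {i j k : ℕ}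
    (h : i + j + k = 5) (hj : j < 5) (hk : k < 5) :
    x (trianglePoint s t u i j k) t - x (trianglePoint s t u i j k) u =
      if i = 0 then 0 else
        x (trianglePoint s t u i 0 (5 - i)) t - x (trianglePoint s t u i 0 (5 - i)) u := by
  rcases i with _ | i
  · have hs : expSupp (trianglePoint s t u 0 j k) = {t, u} := by
      ext l
      simp only [mem_expSupp, trianglePoint, e, Finset.mem_insert, Finset.mem_singleton]
      grind
    have hth : thirds (expSupp (trianglePoint s t u 0 j k)) = {t, u}ᶜ := by
      rw [hs, thirds_of_card_two (Finset.card_pair htu)]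
    have hn : trianglePoint s t u 0 j k ∈ nodes :=
      mem_nodes_of_mem_thirds (a := s) (by rw [sum_trianglePoint]; omega)
        (by simp [hth, hst, hsu])
    rw [hx.supp _ hn t (by simp [hth]), hx.supp _ hn u (by simp [hth])]
    simp
  · rw [hx.sub_eq_line hst hsu htu i j k h, show 5 - (i + 1) = j + k by omega]
    simp

lemma eq_of_lt (hx : IsFlat x) (hst : s ≠ t) (hsu : s ≠ u) (htu : t ≠ u) {i j k : ℕ}
    (h : i + j + k = 5) (hi : i < 5) (hj : j < 5) (hk : k < 5) :
    x (trianglePoint s t u i j k) t = x (trianglePoint s t u i j k) u := by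
  rw [← sub_eq_zero, hx.sub_eq hst hsu htu h hj hk]
  let α : Fin 5 → Fin 5 → Fin 5 → ℕ → ℚ := fun s t u i => if i = 0 then 0 else
    x (trianglePoint s t u i 0 (5 - i)) t - x (trianglePoint s t u i 0 (5 - i)) u
  refine affine_eq_zero (α := α s t u) (β := α t u s) (γ := α u s t) rfl rfl rfl ?_ hi
  intro i j k h hi hj hk
  have h1 := hx.sub_eq hst hsu htu h hj hk
  have h2 := hx.sub_eq htu hst.symm hsu.symm (show j + k + i = 5 by omega) hk hi
  have h3 := hx.sub_eq hsu.symm htu.symm hst (show k + i + j = 5 by omega) hi hj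
  rw [trianglePoint_rotate] at h2
  rw [← trianglePoint_rotate u s t] at h3
  simp only [α]
  linarith

lemma eq_zero (hx : IsFlat x) {m : Fin 5 → ℕ} (hm : m ∈ nodes) (a : Fin 5) : x m a = 0 := by
  by_cases ha : a ∉ thirds (expSupp m)
  · exact hx.supp m hm a ha
  rw [not_not] at ha
  obtain ⟨h5, h3⟩ := mem_nodes.1 hm
  rcases card_eq_of_card_thirds h3 with hc | hc
  · rw [thirds_of_card_two hc] at ha
    obtain ⟨s, t, hst, hS⟩ := Finset.card_eq_two.1 hc
    have hsupp : ∀ l, m l ≠ 0 ↔ l = s ∨ l = t := fun l => by simp [← mem_expSupp, hS]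
    have has : a ≠ s ∧ a ≠ t := by simpa [hS] using ha
    have hp := eq_trianglePoint (m := m) has.1 has.2 hst (by grind)
    have hsum := h5
    rw [hp, sum_trianglePoint] at hsum
    have := (hsupp s).2 (by simp)
    have := (hsupp t).2 (by simp)
    have : m a = 0 := by grind
    have h := hx.eq_of_lt hst.symm has.2.symm has.1.symm
      (i := m t) (j := m s) (k := m a) (by omega) (by omega) (by omega) (by omega)
    rw [← eq_trianglePoint hst.symm has.2.symm has.1.symm (by grind)] at h
    rw [← h]
    exact hx.supp m hm s (by rw [thirds_of_card_two hc]; simp [hS])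
  · have hth := thirds_of_card_three hc
    rw [hth] at ha
    obtain ⟨s, t, u, hst, hsu, htu, hS⟩ := Finset.card_eq_three.1 hc
    have hsupp : ∀ l, m l ≠ 0 ↔ l = s ∨ l = t ∨ l = u := fun l => by simp [← mem_expSupp, hS]
    have hp := eq_trianglePoint (m := m) hst hsu htu (by grind)
    have hsum := h5
    rw [hp, sum_trianglePoint] at hsum
    have := (hsupp s).2 (by simp)
    have := (hsupp t).2 (by simp)
    have := (hsupp u).2 (by simp)
    have h1 := hx.eq_of_lt hst hsu htu hsum (by omega) (by omega) (by omega)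
    have h2 := hx.eq_of_lt htu hst.symm hsu.symm (i := m t) (j := m u) (k := m s)
      (by omega) (by omega) (by omega) (by omega)
    rw [trianglePoint_rotate] at h2
    rw [← hp] at h1 h2
    have h0 := hx.sum_eq_zero m hm
    rw [← Finset.sum_subset (Finset.subset_univ (expSupp m))
      (fun l _ hl => hx.supp m hm l (by rwa [hth])), hS, Finset.sum_insert (by simp [hst, hsu]),
      Finset.sum_pair htu] at h0
    have : a = s ∨ a = t ∨ a = u := by simpa [hS] using ha
    rcases this with rfl | rfl | rfl <;> linarith

end IsFlat

lemma starVec_eq_zero {x : (Fin 5 → ℕ) → Fin 5 → ℚ}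
    (hsupp : ∀ m ∈ nodes, ∀ a ∉ thirds (expSupp m), x m a = 0)
    (hsum : ∀ m ∈ nodes, ∑ a, x m a = 0) (h : ∑ m ∈ nodes, starVec m (x m) = 0)
    {m : Fin 5 → ℕ} (hm : m ∈ nodes) (a : Fin 5) : x m a = 0 := by
  refine IsFlat.eq_zero ⟨fun p a b hab hb h5 ha => ?_, hsupp, hsum⟩ hm a
  have hb' := mem_thirds_shift hb ha
  have h1 := DFunLike.congr_fun h s(p, shift p a b)
  simp only [Finsupp.coe_finsetSum, Finset.sum_apply, starVec_coeff _ _ hab hb ha hb',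
    Finset.sum_add_distrib, Finset.sum_ite_eq', mem_nodes_of_mem_thirds h5 ha,
    mem_nodes_of_mem_thirds ((sum_shift hab hb).trans h5) hb', if_true, Finsupp.zero_apply] at h1
  linarith

lemma gvec_comm (m n : Fin 5 → ℕ) : gvec m n = gvec n m := by
  rw [gvec, gvec, Sym2.eq_swap]

lemma isGammaPair_shift {m : Fin 5 → ℕ} {a b : Fin 5} (hm : ∑ i, m i = 5) (hab : a ≠ b)
    (ha : a ∈ thirds (expSupp m)) (hb : m b ≠ 0) : IsGammaPair m (shift m a b) := by
  refine ⟨hm, (sum_shift hab hb).trans hm, ⟨b, a, hab.symm, (shift_shift hab hb).symm⟩, ?_⟩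
  rw [mem_thirds] at ha
  rw [← ha, ← Set.ncard_coe_finset]
  congr 1
  ext k
  simp only [Set.mem_union, Function.mem_support, Finset.coe_insert, Set.mem_insert_iff,
    Finset.mem_coe, mem_expSupp, shift_apply]
  grind

lemma IsGammaPair.exists_shift {m n : Fin 5 → ℕ} (h : IsGammaPair m n) :
    ∃ a b, a ≠ b ∧ a ∈ thirds (expSupp m) ∧ m b ≠ 0 ∧ n = shift m a b := by
  obtain ⟨hm, hn, ⟨b, a, hab, rfl⟩, hc⟩ := h
  have ha : n a ≠ 0 := by
    intro ha
    have h1 : ∀ k, n k + e b k - e a k = n k + if k = b then 1 else 0 := by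
      intro k
      simp only [e]
      grind
    simp [h1, Finset.sum_add_distrib, hn] at hm
  change (Function.support (shift n b a) ∪ _).ncard = 3 at hc
  refine ⟨a, b, hab.symm, ?_, shift_fst_ne_zero hab, (shift_shift hab ha).symm⟩
  change a ∈ thirds (expSupp (shift n b a))
  rw [mem_thirds, ← hc, ← Set.ncard_coe_finset]
  congr 1
  ext k
  simp only [Set.mem_union, Function.mem_support, Finset.coe_insert, Set.mem_insert_iff,
    Finset.mem_coe, mem_expSupp, shift_apply]
  grind

lemma gammaSpan_eq :
    GammaSpan = Submodule.span ℚ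
      (Set.range fun p : gammaIndex => gvec p.1.1 (shift p.1.1 p.1.2.1 p.1.2.2)) := by
  apply le_antisymm
  · rw [GammaSpan, Submodule.span_le]
    rintro _ ⟨m, n, h, rfl⟩
    obtain ⟨a, b, hab, ha, hb, rfl⟩ := h.exists_shift
    apply Submodule.subset_span
    rcases lt_or_gt_of_ne hab with hlt | hlt
    · refine ⟨⟨(m, a, b), ?_⟩, rfl⟩
      exact mem_gammaIndex.2 ⟨h.1, hlt, hb, ha⟩
    · refine ⟨⟨(shift m a b, b, a), ?_⟩, ?_⟩
      · exact mem_gammaIndex.2 ⟨h.2.1, hlt, shift_fst_ne_zero hab, mem_thirds_shift hb ha⟩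
      · simp only [shift_shift hab hb]
        exact gvec_comm _ _
  · rw [Submodule.span_le]
    rintro _ ⟨⟨⟨m, a, b⟩, hp⟩, rfl⟩
    rw [mem_gammaIndex] at hp
    exact Submodule.subset_span
      ⟨_, _, isGammaPair_shift hp.1 hp.2.1.ne hp.2.2.2 hp.2.2.1, rfl⟩

lemma finrank_gammaSpan : Module.finrank ℚ GammaSpan = 300 := by
  rw [gammaSpan_eq, finrank_span_eq_card, Fintype.card_coe, card_gammaIndex]
  have hinj : Function.Injective
      fun p : gammaIndex => s(p.1.1, shift p.1.1 p.1.2.1 p.1.2.2) := by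
    rintro ⟨⟨m, a, b⟩, hp⟩ ⟨⟨n, c, d⟩, hq⟩ h
    rw [mem_gammaIndex] at hp hq
    rcases (sym2_shift_eq_iff hp.2.1.ne hp.2.2.1 hq.2.1.ne hq.2.2.1).1 h with
      ⟨rfl, rfl, rfl⟩ | ⟨-, rfl, rfl⟩
    · rfl
    · exact absurd hp.2.1 hq.2.1.asymm
  have := (Finsupp.basisSingleOne (R := ℚ) (ι := Sym2 (Fin 5 → ℕ))).linearIndependent.comp _ hinj
  simpa [Function.comp_def, gvec] using this

lemma starVec_mem_gammaSpan {m : Fin 5 → ℕ} (hm : ∑ i, m i = 5) (y : Fin 5 → ℚ) :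
    starVec m y ∈ GammaSpan := by
  rw [starVec_apply]
  refine Submodule.sum_mem _ fun a ha => Submodule.sum_mem _ fun b hb => ?_
  by_cases hab : a = b
  · simp [hab]
  · exact Submodule.smul_mem _ _ (Submodule.subset_span
      ⟨_, _, isGammaPair_shift hm hab ha (mem_expSupp.1 hb), rfl⟩)

lemma expSupp_eq {m : Fin 5 → ℕ} {T : Finset (Fin 5)} (h : Function.support m = T) :
    expSupp m = T := by
  ext k
  rw [mem_expSupp, ← Function.mem_support, h, Finset.mem_coe]

lemma Rvec_eq {m : Fin 5 → ℕ} {s t u : Fin 5} (hst : s ≠ t) (hsu : s ≠ u) (htu : t ≠ u)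
    (h : expSupp m = {s, t, u}) : Rvec m s t u = starVec m (Pi.single u 1) := by
  have hc : (expSupp m).card = 3 := Finset.card_eq_three.2 ⟨s, t, u, hst, hsu, htu, h⟩
  rw [starVec_apply, thirds_of_card_three hc, h]
  have hs : s ∉ ({t, u} : Finset (Fin 5)) := by simp [hst, hsu]
  simp only [Finset.sum_insert hs, Finset.sum_pair htu, Pi.single_apply, hsu, htu, if_true,
    if_false, Rvec]
  change gvec m (shift m s u) + gvec m (shift m t u) - gvec m (shift m u t) -
    gvec m (shift m u s) = _
  module

lemma Evec_eq {m : Fin 5 → ℕ} {i j k l : Fin 5} (hij : i ≠ j) (hkl : k ≠ l)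
    (h : expSupp m = {i, j}) (hk : k ∉ ({i, j} : Finset (Fin 5)))
    (hl : l ∉ ({i, j} : Finset (Fin 5))) :
    Evec m i j k l = starVec m (Pi.single l 1 - Pi.single k 1) := by
  have hg : ∀ a, a ∉ ({i, j} : Finset (Fin 5)) → ∀ b, b ∈ ({i, j} : Finset (Fin 5)) →
      gvec m (fun c => m c - e b c + e a c) = gvec m (shift m a b) := by
    intro a ha b hb
    congr 1
    have hb0 : m b ≠ 0 := by rwa [← mem_expSupp, h]
    funext c
    simp only [shift_apply, e]
    grind
  have hi : i ∈ ({i, j} : Finset (Fin 5)) := by simp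
  have hj : j ∈ ({i, j} : Finset (Fin 5)) := by simp
  have hne : ∀ a ∉ ({i, j} : Finset (Fin 5)), i ≠ a ∧ j ≠ a := by
    intro a ha
    simpa [eq_comm] using ha
  rw [Evec, hg k hk i hi, hg k hk j hj, hg l hl i hi, hg l hl j hj, starVec_apply,
    thirds_of_card_two (h ▸ Finset.card_pair hij), h,
    ← Finset.sum_subset (s₁ := {k, l}) (by
      intro a ha
      simp only [Finset.mem_insert, Finset.mem_singleton] at ha
      rw [Finset.mem_compl]
      rcases ha with rfl | rfl <;> assumption)]
  · simp only [Finset.sum_pair hij, Finset.sum_pair hkl, Pi.sub_apply, Pi.single_apply, hkl,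
      hkl.symm, hne k hk, hne l hl, if_true, if_false]
    module
  · intro a _ ha
    simp only [Finset.mem_insert, Finset.mem_singleton, not_or] at ha
    simp [Finset.sum_pair hij, Pi.single_apply, ha, hne k hk, hne l hl]

lemma starVec_single_mem {m : Fin 5 → ℕ} (hm : ∑ i, m i = 5) (hc : (expSupp m).card = 3)
    {a : Fin 5} (ha : a ∈ expSupp m) : starVec m (Pi.single a 1) ∈ RelSpan := by
  obtain ⟨s, t, hst, hS⟩ := Finset.card_eq_two.1
    (show ((expSupp m).erase a).card = 2 by rw [Finset.card_erase_of_mem ha, hc])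
  have hS' : expSupp m = {s, t, a} := by
    rw [← Finset.insert_erase ha, hS]
    ext
    simp only [Finset.mem_insert, Finset.mem_singleton]
    tauto
  have hsa : s ≠ a := Finset.ne_of_mem_erase (s := expSupp m) (by simp [hS])
  have hta : t ≠ a := Finset.ne_of_mem_erase (s := expSupp m) (by simp [hS])
  rw [← Rvec_eq hst hsa hta hS']
  refine Submodule.subset_span (Or.inl ⟨m, s, t, a, hm, hst, hsa, hta, ?_, rfl⟩)
  ext k
  simpa using Finset.ext_iff.1 hS' k

lemma starVec_single_sub_mem {m : Fin 5 → ℕ} (hm : m ∈ nodes) {a c : Fin 5}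
    (ha : a ∈ thirds (expSupp m)) (hc : c ∈ thirds (expSupp m)) :
    starVec m (Pi.single a 1 - Pi.single c 1) ∈ RelSpan := by
  obtain ⟨h5, h3⟩ := mem_nodes.1 hm
  rcases card_eq_of_card_thirds h3 with h | h
  · by_cases hac : a = c
    · simp [hac]
    rw [thirds_of_card_two h] at ha hc
    obtain ⟨i, j, hij, hS⟩ := Finset.card_eq_two.1 h
    rw [hS, Finset.mem_compl] at ha hc
    rw [← Evec_eq hij (Ne.symm hac) hS hc ha]
    refine Submodule.subset_span (Or.inr ⟨m, i, j, c, a, h5, hij, ?_, Ne.symm hac,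
      by simpa using hc, by simpa using ha, rfl⟩)
    ext k
    simpa using Finset.ext_iff.1 hS k
  · rw [thirds_of_card_three h] at ha hc
    rw [map_sub]
    exact Submodule.sub_mem _ (starVec_single_mem h5 h ha) (starVec_single_mem h5 h hc)

lemma relSpan_le {M : Submodule ℚ V}
    (h : ∀ m ∈ nodes, ∀ y : Fin 5 → ℚ, (∀ a ∉ thirds (expSupp m), y a = 0) → ∑ a, y a = 0 →
      starVec m y ∈ M) : RelSpan ≤ M := by
  rw [RelSpan, Submodule.span_le]
  rintro _ (⟨m, s, t, u, hm, hst, hsu, htu, hs, rfl⟩ |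
    ⟨m, i, j, k, l, hm, hij, hs, hkl, hk, hl, rfl⟩)
  · have hS : expSupp m = {s, t, u} := expSupp_eq (by simpa using hs)
    have hc : (expSupp m).card = 3 := Finset.card_eq_three.2 ⟨s, t, u, hst, hsu, htu, hS⟩
    have hn : m ∈ nodes := mem_nodes.2 ⟨hm, by rw [thirds_of_card_three hc, hc]⟩
    have hzero : starVec m (fun a => if a ∈ expSupp m then 1 else 0) = 0 := by
      rw [starVec_apply, thirds_of_card_three hc]
      refine Finset.sum_eq_zero fun a ha => Finset.sum_eq_zero fun b hb => ?_
      simp only [if_pos ha, if_pos hb, sub_self, zero_smul]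
    rw [Rvec_eq hst hsu htu hS, SetLike.mem_coe,
      ← sub_zero (starVec m _), ← smul_zero (3⁻¹ : ℚ), ← hzero, ← map_smul, ← map_sub]
    refine h m hn _ (fun a ha => ?_) ?_
    · rw [thirds_of_card_three hc] at ha
      have hau : a ≠ u := by rintro rfl; simp [hS] at ha
      simpa [hau] using ha
    · simp [Finset.sum_sub_distrib, -mem_expSupp, hc]
  · have hS : expSupp m = {i, j} := expSupp_eq (by simpa using hs)
    have hc : (expSupp m).card = 2 := hS ▸ Finset.card_pair hij
    have hk' : k ∈ thirds (expSupp m) := by rw [thirds_of_card_two hc, hS]; simpa using hk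
    have hl' : l ∈ thirds (expSupp m) := by rw [thirds_of_card_two hc, hS]; simpa using hl
    rw [Evec_eq hij hkl hS (by simpa using hk) (by simpa using hl)]
    refine h m (mem_nodes_of_mem_thirds hm hk') _ (fun a ha => ?_) (by simp)
    have hak : a ≠ k := by rintro rfl; exact ha hk'
    have hal : a ≠ l := by rintro rfl; exact ha hl'
    simp [hak, hal]

lemma relSpan_le_gammaSpan : RelSpan ≤ GammaSpan :=
  relSpan_le fun _ hm y _ _ => starVec_mem_gammaSpan (mem_nodes.1 hm).1 y

lemma finrank_relSpan : Module.finrank ℚ RelSpan = 200 := by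
  have hex : ∀ m : nodes, ∃ a b c, a ≠ b ∧ a ≠ c ∧ b ≠ c ∧ thirds (expSupp m.1) = {a, b, c} :=
    fun m => Finset.card_eq_three.1 (mem_nodes.1 m.2).2
  choose a b c hab hac hbc hT using hex
  let y : nodes → (Fin 2 → ℚ) → Fin 5 → ℚ := fun m z =>
    z 0 • (Pi.single (a m) 1 - Pi.single (c m) 1) + z 1 • (Pi.single (b m) 1 - Pi.single (c m) 1)
  let v : nodes × Fin 2 → V := fun p => starVec p.1 (y p.1 (Pi.single p.2 1))
  have hy : ∀ m z, starVec m.1 (y m z) = ∑ i, z i • v (m, i) := by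
    intro m z
    simp [y, v, Fin.sum_univ_two]
  have ysupp : ∀ m z, ∀ l ∉ thirds (expSupp m.1), y m z l = 0 := by
    intro m z l hl
    simp only [hT, Finset.mem_insert, Finset.mem_singleton, not_or] at hl
    simp [y, hl]
  have ysum : ∀ m z, ∑ l, y m z l = 0 := by
    intro m z
    simp [y, Finset.sum_add_distrib, ← Finset.mul_sum]
  have hli : LinearIndependent ℚ v := by
    rw [Fintype.linearIndependent_iff]
    intro g hg
    let x : (Fin 5 → ℕ) → Fin 5 → ℚ := fun m =>
      if hm : m ∈ nodes then y ⟨m, hm⟩ fun i => g (⟨m, hm⟩, i) else 0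
    have hx : ∀ m : nodes, x m = y m fun i => g (m, i) := fun m => dif_pos m.2
    have hzero : ∑ m ∈ nodes, starVec m (x m) = 0 := by
      rw [← Finset.sum_coe_sort nodes, ← hg, Fintype.sum_prod_type]
      exact Finset.sum_congr rfl fun m _ => by
        rw [hx]
        exact hy m (fun i => g (m, i))
    have h0 : ∀ (m : nodes) l, y m (fun i => g (m, i)) l = 0 := by
      intro m l
      rw [← hx]
      refine starVec_eq_zero (fun m hm => ?_) (fun m hm => ?_) hzero m.2 l
      · rw [hx ⟨m, hm⟩]
        exact ysupp ⟨m, hm⟩ fun i => g (⟨m, hm⟩, i)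
      · rw [hx ⟨m, hm⟩]
        exact ysum ⟨m, hm⟩ fun i => g (⟨m, hm⟩, i)
    rintro ⟨m, i⟩
    have h1 := h0 m (a m)
    have h2 := h0 m (b m)
    simp [y, hab, hac, hbc, (hab _).symm] at h1 h2
    fin_cases i
    exacts [h1, h2]
  have hspan : RelSpan = Submodule.span ℚ (Set.range v) := by
    apply le_antisymm
    · refine relSpan_le fun m hm w hw hsum => ?_
      have : w = y ⟨m, hm⟩ ![w (a ⟨m, hm⟩), w (b ⟨m, hm⟩)] := by
        have hT' := hT ⟨m, hm⟩
        have hab' := hab ⟨m, hm⟩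
        have hac' := hac ⟨m, hm⟩
        have hbc' := hbc ⟨m, hm⟩
        rw [← Finset.sum_subset (Finset.subset_univ _) (fun l _ hl => hw l hl), hT',
          Finset.sum_insert (by simp [hab', hac']), Finset.sum_pair hbc'] at hsum
        funext l
        by_cases hl : l ∈ thirds (expSupp m)
        · rw [hT'] at hl
          simp only [Finset.mem_insert, Finset.mem_singleton] at hl
          rcases hl with rfl | rfl | rfl
          · simp [y, hab', hac']
          · simp [y, hab'.symm, hbc']
          · simp [y, hac'.symm, hbc'.symm]
            linarith
        · rw [hw l hl, ysupp ⟨m, hm⟩ _ l hl]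
      rw [this, hy ⟨m, hm⟩]
      exact Submodule.sum_mem _ fun i _ =>
        Submodule.smul_mem _ _ (Submodule.subset_span ⟨_, rfl⟩)
    · rw [Submodule.span_le]
      rintro _ ⟨⟨m, i⟩, rfl⟩
      simp only [v, y, map_add, map_smul]
      have ha : a m ∈ thirds (expSupp m.1) := by simp [hT]
      have hb : b m ∈ thirds (expSupp m.1) := by simp [hT]
      have hc : c m ∈ thirds (expSupp m.1) := by simp [hT]
      exact Submodule.add_mem _ (Submodule.smul_mem _ _ (starVec_single_sub_mem m.2 ha hc))
        (Submodule.smul_mem _ _ (starVec_single_sub_mem m.2 hb hc))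
  rw [hspan, finrank_span_eq_card hli, Fintype.card_prod, Fintype.card_coe, card_nodes,
    Fintype.card_fin]

/-- The relations `R^{st,u}_m` and `E^{k,k'}_m` span a subspace of dimension
exactly 200 of the 300-dimensional space spanned by the γ-pairs;
equivalently, the quotient — the space of classes of compact γ curves — has
dimension exactly 100. -/
theorem rank_of_all_gamma_relations :
    Module.finrank ℚ RelSpan = 200 ∧
    Module.finrank ℚ
      (GammaSpan ⧸ (RelSpan.comap GammaSpan.subtype)) = 100 := by
  have : FiniteDimensional ℚ GammaSpan :=
    FiniteDimensional.of_finrank_pos (by rw [finrank_gammaSpan]; norm_num)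
  have h := Submodule.finrank_quotient_add_finrank (RelSpan.comap GammaSpan.subtype)
  rw [(Submodule.comapSubtypeEquivOfLe relSpan_le_gammaSpan).finrank_eq, finrank_relSpan,
    finrank_gammaSpan] at h
  exact ⟨finrank_relSpan, by omega⟩
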